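/- For every natural number m ≥ 21, the tail Σ_{k=m}^{∞} (4/(k(k+1)(k+2)))·√((k(5k+21) − 18)/(2(k+3))) is at most 8√3 / (3·(m−1)^{3/2}). -/

import Mathlib

/-- The term `nₖ √(3 n_{k,1}/nₖ + k) = (4/(k(k+1)(k+2))) √((k(5k+21) - 18)/(2(k+3)))`
of the Barabási–Albert bound. -/
noncomputable def baTerm (k : ℕ) : ℝ :=
  4 / ((k : ℝ) * ((k : ℝ) + 1) * ((k : ℝ) + 2)) *
    Real.sqrt (((k : ℝ) * (5 * (k : ℝ) + 21) - 18) / (2 * ((k : ℝ) + 3)))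

theorem rpow_three_halves_eq_sqrt_pow {x : ℝ} (hx : 0 ≤ x) :
    x ^ ((3 : ℝ) / 2) = Real.sqrt x ^ 3 := by
  rw [Real.sqrt_eq_rpow, ← Real.rpow_natCast, ← Real.rpow_mul hx]
  norm_num

theorem baTerm_nonneg (k : ℕ) : 0 ≤ baTerm k := by
  unfold baTerm
  positivity

/-- The pointwise bound `baTerm k ≤ 4√3 / k^{5/2}`. -/
theorem baTerm_le {k : ℕ} (hk : 1 ≤ k) :
    baTerm k ≤ 4 * Real.sqrt 3 / Real.sqrt k ^ 5 := by
  have hk' : (1 : ℝ) ≤ k := by exact_mod_cast hk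
  have hpos : (0 : ℝ) < k := by linarith
  have hs : 0 < Real.sqrt k := Real.sqrt_pos.mpr hpos
  have hsq : Real.sqrt k ^ 2 = k := Real.sq_sqrt hpos.le
  have hroot : Real.sqrt (((k : ℝ) * (5 * k + 21) - 18) / (2 * (k + 3))) ≤
      Real.sqrt 3 * Real.sqrt k := by
    rw [← Real.sqrt_mul (by norm_num)]
    apply Real.sqrt_le_sqrt
    rw [div_le_iff₀ (by positivity)]
    nlinarith [sq_nonneg ((k : ℝ) - 2)]
  have hcoeff : 4 / ((k : ℝ) * (k + 1) * (k + 2)) ≤ 4 / (k : ℝ) ^ 3 := by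
    apply div_le_div_of_nonneg_left (by norm_num) (by positivity)
    nlinarith [sq_nonneg (k : ℝ)]
  calc baTerm k ≤ 4 / (k : ℝ) ^ 3 * (Real.sqrt 3 * Real.sqrt k) :=
        mul_le_mul hcoeff hroot (Real.sqrt_nonneg _) (by positivity)
    _ = 4 / (Real.sqrt k ^ 2) ^ 3 * (Real.sqrt 3 * Real.sqrt k) := by rw [hsq]
    _ = 4 * Real.sqrt 3 / Real.sqrt k ^ 5 := by field_simp

/-- Convexity of `x ↦ x^{-3/2}` between `a² = b² - 1` and `b²`. -/
theorem three_halves_div_pow_five_le {a b : ℝ} (ha : 0 < a) (hb : 0 < b)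
    (hab : b ^ 2 = a ^ 2 + 1) : 3 / (2 * b ^ 5) ≤ 1 / a ^ 3 - 1 / b ^ 3 := by
  have hkey : a ^ 3 * (3 + 2 * b ^ 2) ≤ 2 * b ^ 5 := by
    have h : 0 ≤ (b - a) ^ 2 * (2 * b ^ 3 + 4 * a * b ^ 2 + 6 * a ^ 2 * b + 3 * a ^ 3) := by
      positivity
    linear_combination h - 3 * a ^ 3 * hab
  have hdiff : 1 / a ^ 3 - 1 / b ^ 3 - 3 / (2 * b ^ 5) =
      (2 * b ^ 5 - a ^ 3 * (3 + 2 * b ^ 2)) / (2 * a ^ 3 * b ^ 5) := by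
    field_simp
    ring
  have : 0 ≤ (2 * b ^ 5 - a ^ 3 * (3 + 2 * b ^ 2)) / (2 * a ^ 3 * b ^ 5) :=
    div_nonneg (by linarith) (by positivity)
  linarith

theorem baTerm_le_sub {k : ℕ} (hk : 2 ≤ k) :
    baTerm k ≤ 8 * Real.sqrt 3 / (3 * ((k : ℝ) - 1) ^ ((3 : ℝ) / 2)) -
      8 * Real.sqrt 3 / (3 * (k : ℝ) ^ ((3 : ℝ) / 2)) := by
  have hk' : (2 : ℝ) ≤ k := by exact_mod_cast hk
  rw [rpow_three_halves_eq_sqrt_pow (by linarith), rpow_three_halves_eq_sqrt_pow (by linarith)]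
  have ha : 0 < Real.sqrt ((k : ℝ) - 1) := Real.sqrt_pos.mpr (by linarith)
  have hb : 0 < Real.sqrt (k : ℝ) := Real.sqrt_pos.mpr (by linarith)
  have hab : Real.sqrt (k : ℝ) ^ 2 = Real.sqrt ((k : ℝ) - 1) ^ 2 + 1 := by
    rw [Real.sq_sqrt (by linarith), Real.sq_sqrt (by linarith)]
    ring
  calc baTerm k ≤ 4 * Real.sqrt 3 / Real.sqrt k ^ 5 := baTerm_le (by omega)
    _ = 8 * Real.sqrt 3 / 3 * (3 / (2 * Real.sqrt k ^ 5)) := by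
        field_simp
        norm_num
    _ ≤ 8 * Real.sqrt 3 / 3 * (1 / Real.sqrt ((k : ℝ) - 1) ^ 3 - 1 / Real.sqrt k ^ 3) :=
        mul_le_mul_of_nonneg_left (three_halves_div_pow_five_le ha hb hab) (by positivity)
    _ = _ := by field_simp

theorem sum_range_baTerm_le {m : ℕ} (hm : 2 ≤ m) (n : ℕ) :
    ∑ k ∈ Finset.range n, baTerm (m + k) ≤
      8 * Real.sqrt 3 / (3 * ((m : ℝ) - 1) ^ ((3 : ℝ) / 2)) -
        8 * Real.sqrt 3 / (3 * (((m + n : ℕ) : ℝ) - 1) ^ ((3 : ℝ) / 2)) := by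
  induction n with
  | zero => simp
  | succ n ih =>
    rw [Finset.sum_range_succ]
    have h := baTerm_le_sub (k := m + n) (by omega)
    have hcast : ((m + (n + 1) : ℕ) : ℝ) - 1 = ((m + n : ℕ) : ℝ) := by
      push_cast
      ring
    rw [hcast]
    linarith

/-- For `m ≥ 21`, the tail `∑_{k=m}^∞ (4/(k(k+1)(k+2))) √((k(5k+21) - 18)/(2(k+3)))`
is at most `8√3/(3(m-1)^{3/2})`. -/
theorem ba_series_tail_le (m : ℕ) (hm : 21 ≤ m) :
    ∑' k : ℕ, baTerm (m + k) ≤ 8 * Real.sqrt 3 / (3 * ((m : ℝ) - 1) ^ ((3 : ℝ) / 2)) := by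
  refine Real.tsum_le_of_sum_range_le (fun k => baTerm_nonneg (m + k)) fun n => ?_
  have hbase : (0 : ℝ) ≤ ((m + n : ℕ) : ℝ) - 1 := by
    have : (1 : ℝ) ≤ ((m + n : ℕ) : ℝ) := by exact_mod_cast (by omega : 1 ≤ m + n)
    linarith
  refine (sum_range_baTerm_le (by omega) n).trans (sub_le_self _ ?_)
  positivity
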